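/- arXiv:1105.1231 — 8 statements merged into one kernel-verified Lean document; each statement's English description precedes it below -/
import Mathlib

section
/- Let n ≥ 2, let x be a point of the unit ball 𝔹ⁿ ⊂ ℝⁿ, let 0 < r < (1−|x|)/√(2(1+|x|²)), and set m₃(r) = log(1 + r/√(1−r²)). Then the j-metric ball B_j(x, m₃(r)) is contained in the chordal ball B_q(x, r); that is, for every y ∈ 𝔹ⁿ with j(x,y) < m₃(r) one has q(x,y) < r. -/
open Real Set

/-- The distance ratio metric (j-metric) on the unit ball of ℝⁿ:
`j(x,y) = log(1 + |x−y| / min(1−|x|, 1−|y|))`. -/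
noncomputable def jdist {n : ℕ} (x y : EuclideanSpace ℝ (Fin n)) : ℝ :=
  Real.log (1 + ‖x - y‖ / min (1 - ‖x‖) (1 - ‖y‖))

/-- The hyperbolic metric of the unit ball of ℝⁿ:
`ρ(x,y) = 2·arcsinh(|x−y| / (√(1−|x|²)·√(1−|y|²)))`. -/
noncomputable def rhodist {n : ℕ} (x y : EuclideanSpace ℝ (Fin n)) : ℝ :=
  2 * Real.arsinh (‖x - y‖ / (Real.sqrt (1 - ‖x‖ ^ 2) * Real.sqrt (1 - ‖y‖ ^ 2)))

/-- The chordal metric on ℝⁿ: `q(x,y) = |x−y| / (√(1+|x|²)·√(1+|y|²))`. -/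
noncomputable def qdist {n : ℕ} (x y : EuclideanSpace ℝ (Fin n)) : ℝ :=
  ‖x - y‖ / (Real.sqrt (1 + ‖x‖ ^ 2) * Real.sqrt (1 + ‖y‖ ^ 2))

/-- The quasihyperbolic metric of the unit ball of ℝⁿ: the infimum over piecewise C¹
paths `γ : [0,1] → 𝔹ⁿ` from `x` to `y` of `∫₀¹ ‖γ′(t)‖ / (1 − ‖γ(t)‖) dt`. -/
noncomputable def kdist {n : ℕ} (x y : EuclideanSpace ℝ (Fin n)) : ℝ :=
  sInf { L : ℝ | ∃ γ : ℝ → EuclideanSpace ℝ (Fin n),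
    γ 0 = x ∧ γ 1 = y ∧ ContinuousOn γ (Set.Icc 0 1) ∧
    (∀ t ∈ Set.Icc (0:ℝ) 1, ‖γ t‖ < 1) ∧
    (∃ s : Finset ℝ, ∀ t ∈ Set.Icc (0:ℝ) 1 \ (s : Set ℝ), DifferentiableAt ℝ γ t) ∧
    L = ∫ t in (0:ℝ)..1, ‖deriv γ t‖ / (1 - ‖γ t‖) }

/-- Elementary inequality behind the comparison of the distance ratio and chordal metrics. -/
lemma sq_one_sub_add_sq_add_le {a b : ℝ} (ha : 0 ≤ a) (hab : a ≤ b) (hb : b < 1) :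
    (1 - b) ^ 2 + (a + b) ^ 2 ≤ (1 + a ^ 2) * (1 + b ^ 2) := by
  have h : 0 ≤ 2 - b - 2 * a + a ^ 2 * b := by
    nlinarith [sq_nonneg (1 - a), mul_nonneg (sub_nonneg.2 hb.le)
      (mul_nonneg (sub_nonneg.2 (hab.trans hb.le)) (by linarith : (0 : ℝ) ≤ 1 + a))]
  nlinarith [mul_nonneg (ha.trans hab) h]

lemma sq_min_add_sq_add_le {a b : ℝ} (ha : 0 ≤ a) (hb : 0 ≤ b) (ha1 : a < 1) (hb1 : b < 1) :
    min (1 - a) (1 - b) ^ 2 + (a + b) ^ 2 ≤ (1 + a ^ 2) * (1 + b ^ 2) := by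
  rcases le_total a b with hab | hab
  · rw [min_eq_right (by linarith)]
    exact sq_one_sub_add_sq_add_le ha hab hb1
  · rw [min_eq_left (by linarith)]
    linarith [sq_one_sub_add_sq_add_le hb hab ha1]

/-- For `x ∈ 𝔹ⁿ`, `0 < r < (1−|x|)/√(2(1+|x|²))` and
`m₃(r) = log(1 + r/√(1−r²))`, the j-ball `B_j(x, m₃(r))` is contained in the
chordal ball `B_q(x, r)`. -/
theorem stmt_2 {n : ℕ} (hn : 2 ≤ n) (x : EuclideanSpace ℝ (Fin n)) (hx : ‖x‖ < 1)
    (r : ℝ) (hr : 0 < r) (hr0 : r < (1 - ‖x‖) / Real.sqrt (2 * (1 + ‖x‖ ^ 2)))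
    (y : EuclideanSpace ℝ (Fin n)) (hy : ‖y‖ < 1)
    (hj : jdist x y < Real.log (1 + r / Real.sqrt (1 - r ^ 2))) :
    qdist x y < r := by
  have ha := norm_nonneg x
  have hb := norm_nonneg y
  have hr1 : r < 1 := by
    refine hr0.trans_le (div_le_one_of_le₀ (Real.le_sqrt_of_sq_le ?_) (Real.sqrt_nonneg _))
    nlinarith
  have hs : 0 < 1 - r ^ 2 := by nlinarith
  have hsq : 0 < Real.sqrt (1 - r ^ 2) := Real.sqrt_pos.2 hs
  have hm : 0 < min (1 - ‖x‖) (1 - ‖y‖) := lt_min (by linarith) (by linarith)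
  have hd : ‖x - y‖ / min (1 - ‖x‖) (1 - ‖y‖) < r / Real.sqrt (1 - r ^ 2) := by
    have h := (Real.log_lt_log_iff (by positivity) (by positivity)).1 hj
    linarith
  rw [div_lt_div_iff₀ hm hsq] at hd
  have hd2 := pow_lt_pow_left₀ hd (by positivity) two_ne_zero
  rw [mul_pow, mul_pow, Real.sq_sqrt hs.le] at hd2
  have htri : ‖x - y‖ ^ 2 ≤ (‖x‖ + ‖y‖) ^ 2 :=
    pow_le_pow_left₀ (norm_nonneg _) (norm_sub_le x y) 2
  have key := mul_le_mul_of_nonneg_left (sq_min_add_sq_add_le ha hb hx hy) (sq_nonneg r)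
  have htri' := mul_le_mul_of_nonneg_left htri (sq_nonneg r)
  rw [qdist, ← Real.sqrt_mul (by positivity), div_lt_iff₀ (by positivity)]
  refine lt_of_pow_lt_pow_left₀ 2 (by positivity) ?_
  rw [mul_pow, Real.sq_sqrt (by positivity)]
  linarith
end

section
/- For every r with 0 < r < 1 one has 4r/5 < log(1 + r/√(1−r²)). -/
open Real Set

lemma cos_sq_mul_cos_add_sin_lt (x : ℝ) :
    cos x ^ 2 * (cos x + sin x) < 5 / 4 := by
  have h1 : sin x ≤ 17 / 8 - 2 * cos x ^ 2 := by
    nlinarith [sq_nonneg (sin x - 1 / 4), sin_sq_add_cos_sq x]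
  have h2 : cos x ^ 2 * sin x ≤ cos x ^ 2 * (17 / 8 - 2 * cos x ^ 2) :=
    mul_le_mul_of_nonneg_left h1 (sq_nonneg _)
  nlinarith [sq_nonneg (cos x ^ 2 - cos x / 4 - 13 / 20), sq_nonneg (cos x - 19 / 20)]

lemma strictMonoOn_log_one_add_tan_sub :
    StrictMonoOn (fun x : ℝ => Real.log (1 + tan x) - 4 / 5 * sin x) (Ico 0 (π / 2)) := by
  have hder : ∀ x ∈ Ico 0 (π / 2),
      HasDerivAt (fun x : ℝ => Real.log (1 + tan x) - 4 / 5 * sin x)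
        (1 / cos x ^ 2 / (1 + tan x) - 4 / 5 * cos x) x := by
    intro x hx
    have hc : 0 < cos x := cos_pos_of_mem_Ioo ⟨by linarith [hx.1, pi_pos], hx.2⟩
    have ht : 0 ≤ tan x := tan_nonneg_of_nonneg_of_le_pi_div_two hx.1 hx.2.le
    exact (((hasDerivAt_tan hc.ne').const_add 1).log (by positivity)).sub
      ((hasDerivAt_sin x).const_mul _)
  refine strictMonoOn_of_deriv_pos (convex_Ico _ _)
    (fun x hx => (hder x hx).continuousAt.continuousWithinAt) fun x hx => ?_
  rw [interior_Ico] at hx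
  rw [(hder x ⟨hx.1.le, hx.2⟩).deriv]
  have hc : 0 < cos x := cos_pos_of_mem_Ioo ⟨by linarith [hx.1, pi_pos], hx.2⟩
  have hs : 0 < sin x := sin_pos_of_pos_of_lt_pi hx.1 (by linarith [hx.2, pi_pos])
  have heq : 1 / cos x ^ 2 / (1 + tan x) = 1 / (cos x * (cos x + sin x)) := by
    rw [tan_eq_sin_div_cos]
    field_simp
  rw [heq, sub_pos, lt_div_iff₀ (by positivity)]
  linarith [cos_sq_mul_cos_add_sin_lt x]

/-- For `0 < r < 1`, `4r/5 < log(1 + r/√(1−r²))`. -/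
theorem stmt_4 (r : ℝ) (hr : 0 < r) (hr1 : r < 1) :
    4 * r / 5 < Real.log (1 + r / Real.sqrt (1 - r ^ 2)) := by
  have hpos : 0 < arcsin r := arcsin_pos.2 hr
  have h := strictMonoOn_log_one_add_tan_sub (left_mem_Ico.2 (by positivity))
    ⟨hpos.le, arcsin_lt_pi_div_two.2 hr1⟩ hpos
  simp only [tan_zero, sin_zero, add_zero, Real.log_one, mul_zero, sub_zero, tan_arcsin,
    sin_arcsin (by linarith : -1 ≤ r) hr1.le] at h
  linarith
end

section
/- Let t ∈ [0,1) and let r ≥ arcsinh(2t/(1−t²)). Then 2t/(1−t) − (1+t)/(1/tanh(r/2) − t) ≤ (1+t)·(e^r − 1)/2. -/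
open Real Set

/-- `exp (arsinh (2t/(1-t²))) = (1+t)/(1-t)`, stated in logarithmic form. -/
theorem arsinh_two_mul_div_one_sub_sq {t : ℝ} (ht0 : 0 ≤ t) (ht1 : t < 1) :
    Real.arsinh (2 * t / (1 - t ^ 2)) = Real.log ((1 + t) / (1 - t)) := by
  have h1 : 0 < 1 - t := by linarith
  have h2 : 0 < 1 - t ^ 2 := by nlinarith
  have hsqrt : √(1 + (2 * t / (1 - t ^ 2)) ^ 2) = (1 + t ^ 2) / (1 - t ^ 2) := by
    rw [Real.sqrt_eq_iff_mul_self_eq_of_pos (by positivity)]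
    field_simp
    ring
  rw [Real.arsinh, hsqrt, ← add_div]
  congr 1
  rw [div_eq_div_iff h2.ne' h1.ne']
  ring

theorem tanh_half_eq (r : ℝ) :
    Real.tanh (r / 2) = (Real.exp r - 1) / (Real.exp r + 1) := by
  have hr : Real.exp r = Real.exp (r / 2) ^ 2 := by
    rw [← Real.exp_nat_mul]
    congr 1
    push_cast
    ring
  rw [Real.tanh_eq, Real.exp_neg, hr]
  have := Real.exp_pos (r / 2)
  field_simp

/-- For `t ∈ [0,1)` and `r ≥ arcsinh(2t/(1−t²))`,
`2t/(1−t) − (1+t)/(1/tanh(r/2) − t) ≤ (1+t)·(e^r − 1)/2`. -/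
theorem stmt_8 (t : ℝ) (ht0 : 0 ≤ t) (ht1 : t < 1)
    (r : ℝ) (hr : Real.arsinh (2 * t / (1 - t ^ 2)) ≤ r) :
    2 * t / (1 - t) - (1 + t) / (1 / Real.tanh (r / 2) - t) ≤
      (1 + t) * (Real.exp r - 1) / 2 := by
  have h1 : 0 < 1 - t := by linarith
  have hE : (1 + t) / (1 - t) ≤ Real.exp r := by
    rw [arsinh_two_mul_div_one_sub_sq ht0 ht1] at hr
    exact (Real.log_le_iff_le_exp (by positivity)).1 hr
  rw [tanh_half_eq]
  obtain ⟨x, hx⟩ : ∃ x, Real.exp r = x + 1 := ⟨Real.exp r - 1, by ring⟩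
  rw [hx] at hE ⊢
  rw [div_le_iff₀ h1] at hE
  have hx2 : 2 * t ≤ x * (1 - t) := by linarith
  have hx0 : 0 ≤ x := by nlinarith
  have hD : 0 < 2 + (1 - t) * x := by positivity
  have hterm : (1 + t) / (1 / ((x + 1 - 1) / (x + 1 + 1)) - t) =
      (1 + t) * x / (2 + (1 - t) * x) := by
    rcases hx0.eq_or_lt with rfl | hpos
    · have : t = 0 := by linarith
      simp [this]
    · have : 1 / ((x + 1 - 1) / (x + 1 + 1)) - t = (2 + (1 - t) * x) / x := by
        rw [add_sub_cancel_right]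
        field_simp
        ring
      rw [this, div_div_eq_mul_div]
  have hfirst : t / (1 - t) ≤ (1 + t) * x / (2 + (1 - t) * x) := by
    rw [div_le_div_iff₀ h1 hD]
    linarith
  have hsecond : t / (1 - t) ≤ (1 + t) * x / 2 := by
    rw [div_le_div_iff₀ h1 two_pos]
    nlinarith
  rw [hterm, mul_div_assoc, add_sub_cancel_right]
  linarith
end

section
/- Let n ≥ 2, let x ∈ 𝔹ⁿ and r > 0. Set m = max{m₁, m₂} where m₁ = log(1 + (1+|x|)·sinh(r/2)) and m₂ = log(1 + (1−|x|)·(e^r − 1)/2), and set M = log(1 + (1+|x|)·(e^r − 1)/2). Then B_j(x, m) ⊂ B_ρ(x, r) and B_ρ(x, r) ⊂ B_j(x, M). -/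
open Real Set

/-- `exp (2 * arsinh (t / D))` in terms of `t`, `D` and `√(t ^ 2 + D ^ 2)`. -/
lemma exp_two_mul_arsinh_div_sub_one {t D : ℝ} (hD : 0 < D) :
    exp (2 * arsinh (t / D)) - 1 = 2 * t * (t + √(t ^ 2 + D ^ 2)) / D ^ 2 := by
  have h1 : √(1 + (t / D) ^ 2) = √(t ^ 2 + D ^ 2) / D := by
    rw [show 1 + (t / D) ^ 2 = (t ^ 2 + D ^ 2) / D ^ 2 by field_simp; ring,
      sqrt_div' _ (sq_nonneg D), sqrt_sq hD.le]
  have h2 : √(t ^ 2 + D ^ 2) ^ 2 = t ^ 2 + D ^ 2 := sq_sqrt (by positivity)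
  rw [two_mul, exp_add, exp_arsinh, h1]
  field_simp
  linear_combination h2

/-- The comparison of `sinh (ρ / 2)` with `|x - y| / min (1 - |x|) (1 - |y|)`. -/
lemma one_add_mul_div_le_div_min {a b t D : ℝ} (ha : 0 ≤ a) (ha1 : a < 1) (hb : 0 ≤ b)
    (hb1 : b < 1) (ht : 0 ≤ t) (hD : 0 < D) (hD2 : D ^ 2 = (1 - a ^ 2) * (1 - b ^ 2)) :
    (1 + a) * (t / D) ≤ t / min (1 - a) (1 - b) := by
  have hm : 0 < min (1 - a) (1 - b) := lt_min (by linarith) (by linarith)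
  have key : (1 + a) * min (1 - a) (1 - b) ≤ D := by
    refine (abs_le_of_sq_le_sq' ?_ hD.le).2
    rw [hD2]
    rcases le_total a b with h | h
    · rw [min_eq_right (by linarith)]
      have h0 : 0 ≤ (1 + a) * (1 - b) * (b - a) :=
        mul_nonneg (mul_nonneg (by linarith) (by linarith)) (by linarith)
      nlinarith
    · rw [min_eq_left (by linarith)]
      have h0 : 0 ≤ (1 + a) * (1 - a) * ((a - b) * (a + b)) :=
        mul_nonneg (mul_nonneg (by linarith) (by linarith))
          (mul_nonneg (by linarith) (by linarith))
      nlinarith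
  rw [← mul_div_assoc, div_le_div_iff₀ hD hm]
  nlinarith [mul_le_mul_of_nonneg_left key ht]

/-- The upper bound for `exp ρ - 1` by `|x - y| / min (1 - |x|) (1 - |y|)`. -/
lemma one_sub_mul_le_div_min {a b t A : ℝ} (ha : 0 ≤ a) (ha1 : a < 1) (hb : 0 ≤ b)
    (hb1 : b < 1) (ht : 0 ≤ t) (htab : t ≤ a + b)
    (hA2 : A ^ 2 = t ^ 2 + (1 - a ^ 2) * (1 - b ^ 2)) :
    (1 - a) * (2 * t * (t + A) / ((1 - a ^ 2) * (1 - b ^ 2))) / 2 ≤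
      t / min (1 - a) (1 - b) := by
  have hm : 0 < min (1 - a) (1 - b) := lt_min (by linarith) (by linarith)
  have hD : 0 < (1 - a ^ 2) * (1 - b ^ 2) := mul_pos (by nlinarith) (by nlinarith)
  have hAab : A ≤ 1 + a * b := (abs_le_of_sq_le_sq' (by nlinarith) (by positivity)).2
  have hs : t + A ≤ (1 + a) * (1 + b) := by linarith
  have key : (1 - a) * (t + A) * min (1 - a) (1 - b) ≤ (1 - a ^ 2) * (1 - b ^ 2) :=
    calc (1 - a) * (t + A) * min (1 - a) (1 - b)
        ≤ (1 - a) * ((1 + a) * (1 + b)) * (1 - b) := by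
          have : 0 ≤ 1 - a := by linarith
          gcongr
          exact min_le_right _ _
      _ = (1 - a ^ 2) * (1 - b ^ 2) := by ring
  rw [show (1 - a) * (2 * t * (t + A) / ((1 - a ^ 2) * (1 - b ^ 2))) / 2 =
    (1 - a) * (t * (t + A)) / ((1 - a ^ 2) * (1 - b ^ 2)) by ring, div_le_div_iff₀ hD hm]
  nlinarith [mul_le_mul_of_nonneg_left key ht]

/-- The lower bound for `exp ρ - 1` by `|x - y| / min (1 - |x|) (1 - |y|)`. -/
lemma div_min_le_one_add_mul {a b t A : ℝ} (ha : 0 ≤ a) (ha1 : a < 1) (hb : 0 ≤ b)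
    (hb1 : b < 1) (ht : 0 ≤ t) (htab : |a - b| ≤ t) (hA : 0 ≤ A)
    (hA2 : A ^ 2 = t ^ 2 + (1 - a ^ 2) * (1 - b ^ 2)) :
    t / min (1 - a) (1 - b) ≤
      (1 + a) * (2 * t * (t + A) / ((1 - a ^ 2) * (1 - b ^ 2))) / 2 := by
  have hm : 0 < min (1 - a) (1 - b) := lt_min (by linarith) (by linarith)
  have hD : 0 < (1 - a ^ 2) * (1 - b ^ 2) := mul_pos (by nlinarith) (by nlinarith)
  have hsq : (a - b) ^ 2 ≤ t ^ 2 := sq_le_sq.2 (by rwa [abs_of_nonneg ht])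
  have hAab : 1 - a * b ≤ A := (abs_le_of_sq_le_sq' (by nlinarith) hA).2
  have key : (1 - a ^ 2) * (1 - b ^ 2) ≤ (1 + a) * (t + A) * min (1 - a) (1 - b) := by
    rcases le_total a b with h | h
    · rw [min_eq_right (by linarith)]
      have hs : (1 - a) * (1 + b) ≤ t + A := by linarith [neg_abs_le (a - b)]
      nlinarith [mul_le_mul_of_nonneg_left hs
        (mul_nonneg (by linarith : 0 ≤ 1 + a) (by linarith : 0 ≤ 1 - b))]
    · rw [min_eq_left (by linarith)]
      have hs : (1 + b) * (1 - b) ≤ t + A := by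
        nlinarith [le_abs_self (a - b), mul_nonneg (sub_nonneg.2 h) (sub_nonneg.2 hb1.le)]
      nlinarith [mul_le_mul_of_nonneg_left hs
        (mul_nonneg (by linarith : 0 ≤ 1 + a) (by linarith : 0 ≤ 1 - a))]
  rw [show (1 + a) * (2 * t * (t + A) / ((1 - a ^ 2) * (1 - b ^ 2))) / 2 =
    (1 + a) * (t * (t + A)) / ((1 - a ^ 2) * (1 - b ^ 2)) by ring, div_le_div_iff₀ hm hD]
  nlinarith [mul_le_mul_of_nonneg_left key ht]

section

variable {n : ℕ} {x y : EuclideanSpace ℝ (Fin n)}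

lemma one_sub_norm_sq_pos (hx : ‖x‖ < 1) : 0 < 1 - ‖x‖ ^ 2 := by
  nlinarith [norm_nonneg x]

lemma sq_sqrt_mul_sqrt_one_sub_norm_sq (hx : ‖x‖ < 1) (hy : ‖y‖ < 1) :
    (√(1 - ‖x‖ ^ 2) * √(1 - ‖y‖ ^ 2)) ^ 2 = (1 - ‖x‖ ^ 2) * (1 - ‖y‖ ^ 2) := by
  rw [mul_pow, sq_sqrt (one_sub_norm_sq_pos hx).le, sq_sqrt (one_sub_norm_sq_pos hy).le]

lemma sqrt_mul_sqrt_one_sub_norm_sq_pos (hx : ‖x‖ < 1) (hy : ‖y‖ < 1) :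
    0 < √(1 - ‖x‖ ^ 2) * √(1 - ‖y‖ ^ 2) :=
  mul_pos (sqrt_pos.2 (one_sub_norm_sq_pos hx)) (sqrt_pos.2 (one_sub_norm_sq_pos hy))

lemma exp_rhodist_sub_one (hx : ‖x‖ < 1) (hy : ‖y‖ < 1) :
    exp (rhodist x y) - 1 =
      2 * ‖x - y‖ * (‖x - y‖ + √(‖x - y‖ ^ 2 + (1 - ‖x‖ ^ 2) * (1 - ‖y‖ ^ 2))) /
        ((1 - ‖x‖ ^ 2) * (1 - ‖y‖ ^ 2)) := by
  rw [rhodist, exp_two_mul_arsinh_div_sub_one (sqrt_mul_sqrt_one_sub_norm_sq_pos hx hy),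
    sq_sqrt_mul_sqrt_one_sub_norm_sq hx hy]

lemma sq_sqrt_norm_sub_sq_add (hx : ‖x‖ < 1) (hy : ‖y‖ < 1) :
    √(‖x - y‖ ^ 2 + (1 - ‖x‖ ^ 2) * (1 - ‖y‖ ^ 2)) ^ 2 =
      ‖x - y‖ ^ 2 + (1 - ‖x‖ ^ 2) * (1 - ‖y‖ ^ 2) :=
  sq_sqrt (add_nonneg (sq_nonneg _)
    (mul_pos (one_sub_norm_sq_pos hx) (one_sub_norm_sq_pos hy)).le)

lemma log_sinh_rhodist_le_jdist (hx : ‖x‖ < 1) (hy : ‖y‖ < 1) {r : ℝ} (hr : 0 < r)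
    (h : r ≤ rhodist x y) : log (1 + (1 + ‖x‖) * sinh (r / 2)) ≤ jdist x y := by
  have h1 := one_add_mul_div_le_div_min (norm_nonneg x) hx (norm_nonneg y) hy
    (norm_nonneg (x - y)) (sqrt_mul_sqrt_one_sub_norm_sq_pos hx hy)
    (sq_sqrt_mul_sqrt_one_sub_norm_sq hx hy)
  have h2 : sinh (r / 2) ≤ ‖x - y‖ / (√(1 - ‖x‖ ^ 2) * √(1 - ‖y‖ ^ 2)) := by
    rw [← sinh_arsinh (‖x - y‖ / _), sinh_le_sinh]
    rw [rhodist] at h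
    linarith
  have h3 : 0 < sinh (r / 2) := sinh_pos_iff.2 (by linarith)
  refine log_le_log (by positivity) ?_
  have : (1 + ‖x‖) * sinh (r / 2) ≤ (1 + ‖x‖) * (‖x - y‖ / _) :=
    mul_le_mul_of_nonneg_left h2 (by positivity)
  linarith

lemma log_exp_rhodist_le_jdist (hx : ‖x‖ < 1) (hy : ‖y‖ < 1) {r : ℝ} (hr : 0 < r)
    (h : r ≤ rhodist x y) : log (1 + (1 - ‖x‖) * (exp r - 1) / 2) ≤ jdist x y := by
  have h1 := one_sub_mul_le_div_min (norm_nonneg x) hx (norm_nonneg y) hy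
    (norm_nonneg (x - y)) (norm_sub_le x y) (sq_sqrt_norm_sub_sq_add hx hy)
  rw [← exp_rhodist_sub_one hx hy] at h1
  have h2 : 0 ≤ 1 - ‖x‖ := by linarith
  have h3 : 0 < exp r - 1 := sub_pos.2 (one_lt_exp_iff.2 hr)
  refine log_le_log (by positivity) ?_
  have h4 := mul_le_mul_of_nonneg_left (exp_le_exp.2 h) h2
  linarith

lemma jdist_lt_log_exp (hx : ‖x‖ < 1) (hy : ‖y‖ < 1) {r : ℝ} (h : rhodist x y < r) :
    jdist x y < log (1 + (1 + ‖x‖) * (exp r - 1) / 2) := by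
  have h1 := div_min_le_one_add_mul (norm_nonneg x) hx (norm_nonneg y) hy
    (norm_nonneg (x - y)) (abs_norm_sub_norm_le x y) (sqrt_nonneg _)
    (sq_sqrt_norm_sub_sq_add hx hy)
  rw [← exp_rhodist_sub_one hx hy] at h1
  have hm : 0 < min (1 - ‖x‖) (1 - ‖y‖) := lt_min (by linarith) (by linarith)
  refine log_lt_log (by positivity) ?_
  have h2 := mul_lt_mul_of_pos_left (exp_lt_exp.2 h) (by positivity : 0 < 1 + ‖x‖)
  linarith

end

/-- For `x ∈ 𝔹ⁿ` and `r > 0`, with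
`m = max{log(1+(1+|x|)·sinh(r/2)), log(1+(1−|x|)·(e^r−1)/2)}` and
`M = log(1+(1+|x|)·(e^r−1)/2)`, one has `B_j(x,m) ⊂ B_ρ(x,r) ⊂ B_j(x,M)`. -/
theorem stmt_9 {n : ℕ} (hn : 2 ≤ n) (x : EuclideanSpace ℝ (Fin n)) (hx : ‖x‖ < 1)
    (r : ℝ) (hr : 0 < r) :
    (∀ y : EuclideanSpace ℝ (Fin n), ‖y‖ < 1 →
      jdist x y < max (Real.log (1 + (1 + ‖x‖) * Real.sinh (r / 2)))
          (Real.log (1 + (1 - ‖x‖) * (Real.exp r - 1) / 2)) →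
      rhodist x y < r) ∧
    (∀ y : EuclideanSpace ℝ (Fin n), ‖y‖ < 1 → rhodist x y < r →
      jdist x y < Real.log (1 + (1 + ‖x‖) * (Real.exp r - 1) / 2)) := by
  refine ⟨fun y hy h => ?_, fun y hy h => jdist_lt_log_exp hx hy h⟩
  contrapose! h
  exact max_le (log_sinh_rhodist_le_jdist hx hy hr h) (log_exp_rhodist_le_jdist hx hy hr h)
end

section
/- Let n ≥ 2 and fix x ∈ 𝔹ⁿ. For r > 0 define m(r) = max{log(1 + (1+|x|)·sinh(r/2)), log(1 + (1−|x|)·(e^r − 1)/2)} and M(r) = log(1 + (1+|x|)·(e^r − 1)/2). Then M(r)/m(r) → 1 as r → 0⁺. -/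
open Real Set

/-- A function vanishing at `0` with derivative `c` there satisfies `r⁻¹ * f r → c` as `r → 0⁺`. -/
theorem tendsto_inv_mul_of_hasDerivAt_zero {f : ℝ → ℝ} {c : ℝ} (hf : HasDerivAt f c 0)
    (h0 : f 0 = 0) :
    Filter.Tendsto (fun r => r⁻¹ * f r) (nhdsWithin 0 (Set.Ioi 0)) (nhds c) := by
  simpa [h0] using hf.tendsto_slope_zero_right

/-- For fixed `x ∈ 𝔹ⁿ`, with
`m(r) = max{log(1+(1+|x|)·sinh(r/2)), log(1+(1−|x|)·(e^r−1)/2)}` and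
`M(r) = log(1+(1+|x|)·(e^r−1)/2)`, one has `M(r)/m(r) → 1` as `r → 0⁺`. -/
theorem stmt_10 {n : ℕ} (hn : 2 ≤ n) (x : EuclideanSpace ℝ (Fin n)) (hx : ‖x‖ < 1) :
    Filter.Tendsto
      (fun r : ℝ =>
        Real.log (1 + (1 + ‖x‖) * (Real.exp r - 1) / 2) /
          max (Real.log (1 + (1 + ‖x‖) * Real.sinh (r / 2)))
            (Real.log (1 + (1 - ‖x‖) * (Real.exp r - 1) / 2)))
      (nhdsWithin 0 (Set.Ioi 0)) (nhds 1) := by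
  have ha : 0 ≤ ‖x‖ := norm_nonneg x
  generalize ‖x‖ = a at ha
  have hexp (b : ℝ) :
      HasDerivAt (fun r : ℝ => Real.log (1 + b * (Real.exp r - 1) / 2)) (b / 2) 0 := by
    have h := (((((Real.hasDerivAt_exp 0).sub_const 1).const_mul b).div_const 2).const_add 1).log
      (by simp)
    simpa using h
  have hsinh :
      HasDerivAt (fun r : ℝ => Real.log (1 + (1 + a) * Real.sinh (r / 2))) ((1 + a) / 2) 0 := by
    have h := (((((hasDerivAt_id (0 : ℝ)).div_const 2).sinh).const_mul (1 + a)).const_add 1).log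
      (by simp)
    simpa [div_eq_mul_inv] using h
  have hM := tendsto_inv_mul_of_hasDerivAt_zero (hexp (1 + a)) (by simp)
  have hm := (tendsto_inv_mul_of_hasDerivAt_zero hsinh (by simp)).max
    (tendsto_inv_mul_of_hasDerivAt_zero (hexp (1 - a)) (by simp))
  rw [max_eq_left (by linarith : (1 - a) / 2 ≤ (1 + a) / 2)] at hm
  have hc : (1 + a) / 2 ≠ 0 := by positivity
  have hlim := hM.div hm hc
  rw [div_self hc] at hlim
  refine hlim.congr' ?_
  filter_upwards [self_mem_nhdsWithin] with r hr
  have hr' : 0 < r⁻¹ := inv_pos.mpr hr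
  simp only [Pi.div_apply]
  rw [← mul_max_of_nonneg _ _ hr'.le, mul_div_mul_left _ _ hr'.ne']
end

section
/- Let n ≥ 2, let x ∈ 𝔹ⁿ and r > 0. Set m = log(1 + 2(e^r − 1)/(1+|x|)) and M = min{2·arcsinh((e^r − 1)/(1+|x|)), log((2e^r − 1 − |x|)/(1 − |x|))}. Then B_ρ(x, m) ⊂ B_j(x, r) and B_j(x, r) ⊂ B_ρ(x, M). -/
open Real Set

theorem two_mul_arsinh_lt_log_iff {t K : ℝ} (ht : 0 ≤ t) (hK : 1 < K) :
    2 * Real.arsinh t < Real.log K ↔ 4 * K * t ^ 2 < (K - 1) ^ 2 := by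
  have hK0 : 0 < K := by linarith
  have hs : 0 < √K := Real.sqrt_pos.2 hK0
  have hsq : √K ^ 2 = K := Real.sq_sqrt hK0.le
  have hsinh : Real.sinh (Real.log √K) = (√K - (√K)⁻¹) / 2 := by
    rw [Real.sinh_eq, Real.exp_neg, Real.exp_log hs]
  calc 2 * Real.arsinh t < Real.log K
      ↔ Real.arsinh t < Real.log √K := by
        rw [Real.log_sqrt hK0.le, lt_div_iff₀ two_pos, mul_comm]
    _ ↔ t < (√K - (√K)⁻¹) / 2 := by
        rw [← Real.arsinh_sinh (Real.log √K), Real.arsinh_lt_arsinh, hsinh]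
    _ ↔ 2 * √K * t < K - 1 := by
        have h : 2 * √K * ((√K - (√K)⁻¹) / 2) = K - 1 := by
          field_simp
          rw [hsq]
        rw [← h, mul_lt_mul_iff_right₀ (by positivity)]
    _ ↔ 4 * K * t ^ 2 < (K - 1) ^ 2 := by
        rw [← sq_lt_sq₀ (by positivity) (by linarith)]
        rw [show (2 * √K * t) ^ 2 = 4 * √K ^ 2 * t ^ 2 by ring, hsq]

theorem rhodist_arg_sq {n : ℕ} {x y : EuclideanSpace ℝ (Fin n)} (hx : ‖x‖ < 1) (hy : ‖y‖ < 1) :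
    (‖x - y‖ / (√(1 - ‖x‖ ^ 2) * √(1 - ‖y‖ ^ 2))) ^ 2 =
      ‖x - y‖ ^ 2 / ((1 - ‖x‖ ^ 2) * (1 - ‖y‖ ^ 2)) := by
  have hx' : 0 ≤ 1 - ‖x‖ ^ 2 := by nlinarith [norm_nonneg x]
  have hy' : 0 ≤ 1 - ‖y‖ ^ 2 := by nlinarith [norm_nonneg y]
  rw [div_pow, mul_pow, Real.sq_sqrt hx', Real.sq_sqrt hy']

theorem rhodist_lt_log_iff {n : ℕ} {x y : EuclideanSpace ℝ (Fin n)} (hx : ‖x‖ < 1) (hy : ‖y‖ < 1)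
    {K : ℝ} (hK : 1 < K) :
    rhodist x y < Real.log K ↔
      4 * K * ‖x - y‖ ^ 2 < (K - 1) ^ 2 * ((1 - ‖x‖ ^ 2) * (1 - ‖y‖ ^ 2)) := by
  have hx' : 0 < 1 - ‖x‖ ^ 2 := by nlinarith [norm_nonneg x]
  have hy' : 0 < 1 - ‖y‖ ^ 2 := by nlinarith [norm_nonneg y]
  rw [rhodist, two_mul_arsinh_lt_log_iff (by positivity) hK, rhodist_arg_sq hx hy,
    ← mul_div_assoc, div_lt_iff₀ (mul_pos hx' hy')]

theorem rhodist_lt_two_mul_arsinh_iff {n : ℕ} {x y : EuclideanSpace ℝ (Fin n)}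
    (hx : ‖x‖ < 1) (hy : ‖y‖ < 1) {s : ℝ} (hs : 0 ≤ s) :
    rhodist x y < 2 * Real.arsinh s ↔
      ‖x - y‖ ^ 2 < s ^ 2 * ((1 - ‖x‖ ^ 2) * (1 - ‖y‖ ^ 2)) := by
  have hx' : 0 < 1 - ‖x‖ ^ 2 := by nlinarith [norm_nonneg x]
  have hy' : 0 < 1 - ‖y‖ ^ 2 := by nlinarith [norm_nonneg y]
  rw [rhodist, mul_lt_mul_iff_right₀ two_pos, Real.arsinh_lt_arsinh,
    ← sq_lt_sq₀ (by positivity) hs, rhodist_arg_sq hx hy, div_lt_iff₀ (mul_pos hx' hy')]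

theorem jdist_lt_iff {n : ℕ} {x y : EuclideanSpace ℝ (Fin n)} (hx : ‖x‖ < 1) (hy : ‖y‖ < 1)
    (r : ℝ) :
    jdist x y < r ↔ ‖x - y‖ < (Real.exp r - 1) * min (1 - ‖x‖) (1 - ‖y‖) := by
  have hm : 0 < min (1 - ‖x‖) (1 - ‖y‖) := lt_min (by linarith) (by linarith)
  rw [jdist, Real.log_lt_iff_lt_exp (by positivity), ← lt_sub_iff_add_lt', div_lt_iff₀ hm]

/-- If the hyperbolic distance of radii `a ≤ b` is less than `log K`, then `K` exceeds the
cross ratio `(1 + b) (1 - a) / ((1 - b) (1 + a))`. -/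
theorem cross_ratio_lt {a b K : ℝ} (ha : 0 ≤ a) (hab : a ≤ b) (hb : b < 1) (hK : 1 < K)
    (h : 4 * K * (b - a) ^ 2 < (K - 1) ^ 2 * ((1 - a ^ 2) * (1 - b ^ 2))) :
    (1 + b) * (1 - a) < K * ((1 - b) * (1 + a)) := by
  by_contra! hc
  have hq : 0 < (1 - b) * (1 + a) := mul_pos (by linarith) (by linarith)
  have hpq : (1 - b) * (1 + a) ≤ (1 + b) * (1 - a) := by nlinarith
  have key : (K - 1) ^ 2 * ((1 - a ^ 2) * (1 - b ^ 2)) - 4 * K * (b - a) ^ 2 =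
      (K * ((1 - b) * (1 + a)) - (1 + b) * (1 - a)) *
        (K * ((1 + b) * (1 - a)) - (1 - b) * (1 + a)) := by ring
  have h2 : 0 ≤ K * ((1 + b) * (1 - a)) - (1 - b) * (1 + a) := by nlinarith
  nlinarith [mul_nonneg (sub_nonneg.2 hc) h2]

theorem dist_lt_of_hyperbolic {a b d K : ℝ} (ha : 0 ≤ a) (ha1 : a < 1) (hb : 0 ≤ b) (hb1 : b < 1)
    (hd : |a - b| ≤ d) (hK : 1 < K)
    (h : 4 * K * d ^ 2 < (K - 1) ^ 2 * ((1 - a ^ 2) * (1 - b ^ 2))) :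
    d < (K - 1) * (1 + a) / 2 * min (1 - a) (1 - b) := by
  have hd0 : 0 ≤ d := (abs_nonneg _).trans hd
  have hsq : (a - b) ^ 2 ≤ d ^ 2 := sq_le_sq' (by linarith [neg_abs_le (a - b)])
    ((le_abs_self _).trans hd)
  have hK1 : 0 < K - 1 := by linarith
  have h' : 4 * K * (a - b) ^ 2 < (K - 1) ^ 2 * ((1 - a ^ 2) * (1 - b ^ 2)) :=
    (mul_le_mul_of_nonneg_left hsq (by linarith)).trans_lt h
  have finish : ∀ c : ℝ, 0 < 1 - c →
      (1 - a ^ 2) * (1 - b ^ 2) ≤ K * ((1 + a) ^ 2 * (1 - c) ^ 2) →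
      d < (K - 1) * (1 + a) / 2 * (1 - c) := by
    intro c hc hle
    refine lt_of_pow_lt_pow_left₀ 2 (by positivity) ?_
    have := h.trans_le (mul_le_mul_of_nonneg_left hle (sq_nonneg (K - 1)))
    have hK0 : 0 < 4 * K := by linarith
    refine lt_of_mul_lt_mul_left (this.trans_eq ?_) hK0.le
    ring
  rcases le_total a b with hab | hab
  · rw [min_eq_right (by linarith)]
    have hc := cross_ratio_lt ha hab hb1 hK (by convert h' using 2; ring)
    refine finish b (by linarith) ?_
    have := mul_le_mul_of_nonneg_right hc.le
      (mul_nonneg (by linarith : 0 ≤ 1 - b) (by linarith : 0 ≤ 1 + a))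
    linear_combination this
  · rw [min_eq_left (by linarith)]
    have hc := cross_ratio_lt hb hab ha1 hK (by convert h' using 2; ring)
    refine finish a (by linarith) ?_
    have h1 : (1 + b) * (1 - b) ≤ K * ((1 - a) * (1 + a)) := by
      have h2 : (1 + b) * ((1 + a) * (1 - b)) ≤ (1 + b) * (K * ((1 - a) * (1 + b))) :=
        mul_le_mul_of_nonneg_left hc.le (by linarith)
      have h3 : (1 + b) * (K * ((1 - a) * (1 + b))) ≤ (1 + a) * (K * ((1 - a) * (1 + a))) := by
        have : 0 ≤ K * (1 - a) := mul_nonneg (by linarith) (by linarith)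
        nlinarith [mul_nonneg this (mul_nonneg (sub_nonneg.2 hab) (by linarith : 0 ≤ 2 + a + b))]
      nlinarith
    have := mul_le_mul_of_nonneg_right h1
      (mul_nonneg (by linarith : 0 ≤ 1 - a) (by linarith : 0 ≤ 1 + a))
    linear_combination this

theorem sq_dist_lt_of_lt_mul_min {a b d E : ℝ} (ha : 0 ≤ a) (ha1 : a < 1) (hb : 0 ≤ b) (hb1 : b < 1)
    (hd : 0 ≤ d) (h : d < E * min (1 - a) (1 - b)) :
    d ^ 2 < (E / (1 + a)) ^ 2 * ((1 - a ^ 2) * (1 - b ^ 2)) := by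
  have hle : (min (1 - a) (1 - b)) ^ 2 * (1 + a) ^ 2 ≤ (1 - a ^ 2) * (1 - b ^ 2) := by
    rcases le_total a b with hab | hab
    · rw [min_eq_right (by linarith)]
      have : (1 - b) * (1 + a) ≤ (1 - a) * (1 + b) := by linarith
      have := mul_le_mul_of_nonneg_right this
        (mul_nonneg (by linarith : 0 ≤ 1 - b) (by linarith : 0 ≤ 1 + a))
      linear_combination this
    · rw [min_eq_left (by linarith)]
      have : (1 - a) * (1 + a) ≤ (1 - b) * (1 + b) := by nlinarith
      have := mul_le_mul_of_nonneg_right this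
        (mul_nonneg (by linarith : 0 ≤ 1 - a) (by linarith : 0 ≤ 1 + a))
      linear_combination this
  have ha' : 1 + a ≠ 0 := by linarith
  calc d ^ 2 < (E * min (1 - a) (1 - b)) ^ 2 := pow_lt_pow_left₀ h hd two_ne_zero
    _ = (E / (1 + a)) ^ 2 * ((min (1 - a) (1 - b)) ^ 2 * (1 + a) ^ 2) := by field_simp
    _ ≤ _ := mul_le_mul_of_nonneg_left hle (sq_nonneg _)

theorem sq_dist_mul_lt_of_lt_mul_min {a b d E : ℝ} (ha : 0 ≤ a) (ha1 : a < 1) (hb : 0 ≤ b)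
    (hb1 : b < 1) (hd : 0 ≤ d) (hdab : d ≤ a + b) (h : d < E * min (1 - a) (1 - b)) :
    d ^ 2 * (1 - a + 2 * E) < E ^ 2 * ((1 + a) * (1 - b ^ 2)) := by
  have hc : 0 < min (1 - a) (1 - b) := lt_min (by linarith) (by linarith)
  have hle : (min (1 - a) (1 - b)) ^ 2 * (1 - a) + 2 * d * min (1 - a) (1 - b) ≤
      (1 + a) * (1 - b ^ 2) := by
    rcases le_total a b with hab | hab
    · rw [min_eq_right (by linarith)]
      nlinarith [mul_nonneg (sub_nonneg.2 hdab) (by linarith : 0 ≤ 1 - b)]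
    · rw [min_eq_left (by linarith)]
      have h1 : d * (1 - a) ≤ (a + b) * (1 - a) :=
        mul_le_mul_of_nonneg_right hdab (by linarith)
      have h2 : 0 ≤ (a - b) * (a + b) := mul_nonneg (by linarith) (by linarith)
      have h3 : 0 ≤ (a - b) * (1 - a) := mul_nonneg (by linarith) (by linarith)
      nlinarith [mul_nonneg h2 ha]
  generalize min (1 - a) (1 - b) = c at *
  have hG : 0 < E * c := hd.trans_lt h
  have hsq : d ^ 2 < (E * c) ^ 2 := pow_lt_pow_left₀ h hd two_ne_zero
  refine lt_of_mul_lt_mul_left ?_ (sq_nonneg c)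
  calc c ^ 2 * (d ^ 2 * (1 - a + 2 * E))
      = d ^ 2 * (c ^ 2 * (1 - a)) + 2 * c * (E * c) * d * d := by ring
    _ < (E * c) ^ 2 * (c ^ 2 * (1 - a)) + 2 * c * (E * c) * d * (E * c) := by
        refine add_lt_add_of_lt_of_le ?_ ?_
        · exact mul_lt_mul_of_pos_right hsq (mul_pos (by positivity) (by linarith))
        · exact mul_le_mul_of_nonneg_left h.le (by positivity)
    _ = (E * c) ^ 2 * (c ^ 2 * (1 - a) + 2 * d * c) := by ring
    _ ≤ (E * c) ^ 2 * ((1 + a) * (1 - b ^ 2)) := mul_le_mul_of_nonneg_left hle (sq_nonneg _)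
    _ = c ^ 2 * (E ^ 2 * ((1 + a) * (1 - b ^ 2))) := by ring

/-- For `x ∈ 𝔹ⁿ` and `r > 0`, with
`m = log(1 + 2(e^r−1)/(1+|x|))` and
`M = min{2·arcsinh((e^r−1)/(1+|x|)), log((2e^r−1−|x|)/(1−|x|))}`, one has
`B_ρ(x,m) ⊂ B_j(x,r) ⊂ B_ρ(x,M)`. -/
theorem stmt_11 {n : ℕ} (hn : 2 ≤ n) (x : EuclideanSpace ℝ (Fin n)) (hx : ‖x‖ < 1)
    (r : ℝ) (hr : 0 < r) :
    (∀ y : EuclideanSpace ℝ (Fin n), ‖y‖ < 1 →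
      rhodist x y < Real.log (1 + 2 * (Real.exp r - 1) / (1 + ‖x‖)) →
      jdist x y < r) ∧
    (∀ y : EuclideanSpace ℝ (Fin n), ‖y‖ < 1 → jdist x y < r →
      rhodist x y < min (2 * Real.arsinh ((Real.exp r - 1) / (1 + ‖x‖)))
        (Real.log ((2 * Real.exp r - 1 - ‖x‖) / (1 - ‖x‖)))) := by
  have hE : 0 < Real.exp r - 1 := sub_pos.2 (Real.one_lt_exp_iff.2 hr)
  have ha := norm_nonneg x
  have hpos : 0 < 1 + ‖x‖ := by linarith
  have hneg : 0 < 1 - ‖x‖ := by linarith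
  refine ⟨fun y hy h => ?_, fun y hy h => ?_⟩
  · have hK : 1 < 1 + 2 * (Real.exp r - 1) / (1 + ‖x‖) := lt_add_of_pos_right _ (by positivity)
    rw [rhodist_lt_log_iff hx hy hK] at h
    rw [jdist_lt_iff hx hy]
    convert dist_lt_of_hyperbolic ha hx (norm_nonneg y) hy (abs_norm_sub_norm_le x y) hK h using 2
    field_simp
    ring
  · rw [jdist_lt_iff hx hy] at h
    refine lt_min ?_ ?_
    · rw [rhodist_lt_two_mul_arsinh_iff hx hy (by positivity)]
      exact sq_dist_lt_of_lt_mul_min ha hx (norm_nonneg y) hy (norm_nonneg _) h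
    · have hform : (2 * Real.exp r - 1 - ‖x‖) / (1 - ‖x‖) =
          1 + 2 * (Real.exp r - 1) / (1 - ‖x‖) := by
        field_simp
        ring
      rw [hform, rhodist_lt_log_iff hx hy (lt_add_of_pos_right _ (by positivity))]
      have key := sq_dist_mul_lt_of_lt_mul_min ha hx (norm_nonneg y) hy (norm_nonneg _)
        (norm_sub_le x y) h
      have hscale : 0 < 4 / (1 - ‖x‖) := by positivity
      refine (Eq.trans_lt ?_ (mul_lt_mul_of_pos_left key hscale)).trans_eq ?_
      · field_simp
      · field_simp
        ring
end

section
/- Let n ≥ 2, let x ∈ 𝔹ⁿ and 0 < r < r₀ where r₀ = (1−|x|)/√(2(1+|x|²)). Define r₁ = |x|/√(1+|x|²), r₂ = 2|x|/(1+|x|²), and M = log[(1−|x|)·(1−r²(1+|x|²)) / (1−|x| − r(1+|x|²)(r+√(1−r²)))]. Define m₁ = log(1 + r(1+|x|²)(√(1−r²) − r|x|) / ((1−|x|)(1−r²(1+|x|²)))) if r < min{r₀, r₂} (i.e., r lies in [0, min{r₀,r₁}) or, when |x| < √2 − 1, in [min{r₀,r₁}, min{r₀,r₂})), and m₁ = +∞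 otherwise; define m₂ = log[(1+|x|)·(1−r²(1+|x|²)) / (1+|x| − r(r+√(1−r²))(1+|x|²))] if |x| < 2 − √3 and r₂ ≤ r < r₀, and m₂ = +∞ otherwise; set m = min{m₁, m₂}. Then B_j(x, m) ⊂ B_q(x, r) and B_q(x, r) ⊂ B_j(x, M). -/
open Real Set

lemma qdist_lt_iff {n : ℕ} (x y : EuclideanSpace ℝ (Fin n)) {r : ℝ} (hr : 0 < r) :
    qdist x y < r ↔ ‖x - y‖ ^ 2 < r ^ 2 * (1 + ‖x‖ ^ 2) * (1 + ‖y‖ ^ 2) := by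
  have hx : 0 < 1 + ‖x‖ ^ 2 := by positivity
  have hy : 0 < 1 + ‖y‖ ^ 2 := by positivity
  unfold qdist
  rw [div_lt_iff₀ (by positivity), ← Real.sqrt_mul hx.le,
    ← sq_lt_sq₀ (norm_nonneg _) (by positivity), mul_pow, Real.sq_sqrt (by positivity), mul_assoc]

lemma jdist_lt_log_iff {n : ℕ} {x y : EuclideanSpace ℝ (Fin n)} (hx : ‖x‖ < 1) (hy : ‖y‖ < 1)
    {c : ℝ} (hc : 0 < 1 + c) :
    jdist x y < Real.log (1 + c) ↔ ‖x - y‖ < c * min (1 - ‖x‖) (1 - ‖y‖) := by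
  have hmin : 0 < min (1 - ‖x‖) (1 - ‖y‖) := lt_min (by linarith) (by linarith)
  unfold jdist
  rw [Real.log_lt_log_iff (by positivity) hc, add_lt_add_iff_left, div_lt_iff₀ hmin]

section ChordalRadius

variable {a r : ℝ}

lemma sq_mul_lt_of_lt_radius (ha : a < 1) (hr : 0 < r)
    (hr0 : r < (1 - a) / Real.sqrt (2 * (1 + a ^ 2))) :
    2 * (r ^ 2 * (1 + a ^ 2)) < (1 - a) ^ 2 := by
  have h : r * Real.sqrt (2 * (1 + a ^ 2)) < 1 - a := by
    rwa [lt_div_iff₀ (by positivity)] at hr0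
  have h2 := (sq_lt_sq₀ (by positivity) (by linarith)).2 h
  rw [mul_pow, Real.sq_sqrt (by positivity)] at h2
  linarith

lemma one_sub_sq_mul_pos (ha0 : 0 ≤ a) (ha : a < 1)
    (h : 2 * (r ^ 2 * (1 + a ^ 2)) < (1 - a) ^ 2) : 0 < 1 - r ^ 2 * (1 + a ^ 2) := by
  nlinarith

lemma one_sub_sq_pos (h : 0 < 1 - r ^ 2 * (1 + a ^ 2)) : 0 < 1 - r ^ 2 := by
  nlinarith [mul_nonneg (sq_nonneg r) (sq_nonneg a)]

lemma one_sub_sub_pos (ha0 : 0 ≤ a) (ha : a < 1)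
    (h : 2 * (r ^ 2 * (1 + a ^ 2)) < (1 - a) ^ 2) :
    0 < 1 - a - r * (1 + a ^ 2) * (r + Real.sqrt (1 - r ^ 2)) := by
  have hD := one_sub_sq_mul_pos ha0 ha h
  have hs := Real.sq_sqrt (one_sub_sq_pos hD).le
  set s := Real.sqrt (1 - r ^ 2)
  have hlt : (r * (1 + a ^ 2) * s) ^ 2 < (1 - a - r ^ 2 * (1 + a ^ 2)) ^ 2 := by
    have h1 : 0 < ((1 - a) ^ 2 - 2 * (r ^ 2 * (1 + a ^ 2))) * (1 - r ^ 2 * (1 + a ^ 2)) :=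
      mul_pos (by linarith) hD
    rw [mul_pow, hs]
    linarith
  have h2 := abs_lt_of_sq_lt_sq hlt (by nlinarith)
  linarith [(abs_lt.1 h2).2]

lemma mul_lt_sqrt_one_sub_sq (hD : 0 < 1 - r ^ 2 * (1 + a ^ 2)) :
    r * a < Real.sqrt (1 - r ^ 2) :=
  Real.lt_sqrt_of_sq_lt (by nlinarith)

lemma discrim_identity (hD : 0 < 1 - r ^ 2 * (1 + a ^ 2)) (e : ℝ) :
    (1 - r ^ 2 * (1 + a ^ 2)) * (e ^ 2 - r ^ 2 * (1 + a ^ 2) * (1 + (a - e) ^ 2)) =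
      ((1 - r ^ 2 * (1 + a ^ 2)) * e + a * (r ^ 2 * (1 + a ^ 2))) ^ 2 -
        (r * (1 + a ^ 2) * Real.sqrt (1 - r ^ 2)) ^ 2 := by
  rw [mul_pow _ (Real.sqrt _), Real.sq_sqrt (one_sub_sq_pos hD).le]
  ring

lemma sq_lt_of_lt_inner_radius (ha0 : 0 ≤ a) (hD : 0 < 1 - r ^ 2 * (1 + a ^ 2)) {e : ℝ}
    (he : 0 ≤ e)
    (h : e < r * (1 + a ^ 2) * (Real.sqrt (1 - r ^ 2) - r * a) / (1 - r ^ 2 * (1 + a ^ 2))) :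
    e ^ 2 < r ^ 2 * (1 + a ^ 2) * (1 + (a - e) ^ 2) := by
  rw [lt_div_iff₀ hD] at h
  have h1 : (1 - r ^ 2 * (1 + a ^ 2)) * e + a * (r ^ 2 * (1 + a ^ 2)) <
      r * (1 + a ^ 2) * Real.sqrt (1 - r ^ 2) := by linarith
  have h2 := (sq_lt_sq₀ (by positivity) (le_trans (by positivity) h1.le)).2 h1
  have h3 := discrim_identity hD e
  by_contra! h4
  nlinarith [mul_nonneg hD.le (sub_nonneg.2 h4)]

lemma lt_outer_radius_of_sq_lt (hr : 0 < r) (hD : 0 < 1 - r ^ 2 * (1 + a ^ 2)) {e : ℝ}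
    (h : e ^ 2 < r ^ 2 * (1 + a ^ 2) * (1 + (a + e) ^ 2)) :
    e < r * (1 + a ^ 2) * (Real.sqrt (1 - r ^ 2) + r * a) / (1 - r ^ 2 * (1 + a ^ 2)) := by
  rw [lt_div_iff₀ hD]
  have h3 := discrim_identity hD (-e)
  have h4 : (1 - r ^ 2 * (1 + a ^ 2)) * ((-e) ^ 2 - r ^ 2 * (1 + a ^ 2) * (1 + (a - -e) ^ 2)) < 0 :=
    mul_neg_of_pos_of_neg hD (by rw [neg_sq, sub_neg_eq_add]; linarith)
  have h5 := abs_lt_of_sq_lt_sq (a := (1 - r ^ 2 * (1 + a ^ 2)) * (-e) + a * (r ^ 2 * (1 + a ^ 2)))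
    (b := r * (1 + a ^ 2) * Real.sqrt (1 - r ^ 2)) (by linarith) (by positivity)
  linarith [(abs_lt.1 h5).1]

end ChordalRadius

lemma qdist_lt_of_norm_sub_lt {n : ℕ} {x y : EuclideanSpace ℝ (Fin n)} {r : ℝ} (hr : 0 < r)
    (hD : 0 < 1 - r ^ 2 * (1 + ‖x‖ ^ 2))
    (h : ‖x - y‖ < r * (1 + ‖x‖ ^ 2) * (Real.sqrt (1 - r ^ 2) - r * ‖x‖) /
      (1 - r ^ 2 * (1 + ‖x‖ ^ 2))) : qdist x y < r := by
  rw [qdist_lt_iff x y hr]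
  refine (sq_lt_of_lt_inner_radius (norm_nonneg x) hD (norm_nonneg _) h).trans_le ?_
  have hy : |‖x‖ - ‖x - y‖| ≤ ‖y‖ := by
    simpa using abs_norm_sub_norm_le x (x - y)
  have := sq_le_sq' (abs_le.1 hy).1 (abs_le.1 hy).2
  gcongr

lemma norm_sub_lt_of_qdist_lt {n : ℕ} {x y : EuclideanSpace ℝ (Fin n)} {r : ℝ} (hr : 0 < r)
    (hD : 0 < 1 - r ^ 2 * (1 + ‖x‖ ^ 2)) (h : qdist x y < r) :
    ‖x - y‖ < r * (1 + ‖x‖ ^ 2) * (Real.sqrt (1 - r ^ 2) + r * ‖x‖) /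
      (1 - r ^ 2 * (1 + ‖x‖ ^ 2)) := by
  rw [qdist_lt_iff x y hr] at h
  refine lt_outer_radius_of_sq_lt hr hD (h.trans_le ?_)
  have hy : ‖y‖ ≤ ‖x‖ + ‖x - y‖ := by
    simpa using norm_sub_le x (x - y)
  gcongr

lemma lt_radius_cases {a r : ℝ} (ha0 : 0 ≤ a) (ha : a < 1)
    (h : 2 * (r ^ 2 * (1 + a ^ 2)) < (1 - a) ^ 2)
    (hr0 : r < (1 - a) / Real.sqrt (2 * (1 + a ^ 2))) :
    (r < min ((1 - a) / Real.sqrt (2 * (1 + a ^ 2))) (a / Real.sqrt (1 + a ^ 2)) ∨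
      (a < Real.sqrt 2 - 1 ∧
        min ((1 - a) / Real.sqrt (2 * (1 + a ^ 2))) (a / Real.sqrt (1 + a ^ 2)) ≤ r ∧
        r < min ((1 - a) / Real.sqrt (2 * (1 + a ^ 2))) (2 * a / (1 + a ^ 2)))) ∨
    (a < 2 - Real.sqrt 3 ∧ 2 * a / (1 + a ^ 2) ≤ r ∧
      r < (1 - a) / Real.sqrt (2 * (1 + a ^ 2))) := by
  by_cases h1 : r < a / Real.sqrt (1 + a ^ 2)
  · exact Or.inl (Or.inl (lt_min hr0 h1))
  rw [not_lt] at h1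
  have h2 : a < Real.sqrt 2 - 1 := by
    have h3 := h1.trans_lt hr0
    rw [Real.sqrt_mul zero_le_two, ← div_div, div_lt_div_iff_of_pos_right (by positivity),
      lt_div_iff₀ (by positivity)] at h3
    have h4 : (Real.sqrt 2) ^ 2 = 2 := Real.sq_sqrt zero_le_two
    nlinarith [Real.sqrt_pos.2 (zero_lt_two (α := ℝ))]
  by_cases h5 : r < 2 * a / (1 + a ^ 2)
  · exact Or.inl (Or.inr ⟨h2, (min_le_right _ _).trans h1, lt_min hr0 h5⟩)
  rw [not_lt] at h5
  refine Or.inr ⟨?_, h5, hr0⟩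
  rw [div_le_iff₀ (by positivity)] at h5
  have h6 := pow_le_pow_left₀ (by positivity) h5 2
  have h7 : 0 < (a ^ 2 - 4 * a + 1) * (a + 1) ^ 2 := by nlinarith [sq_nonneg a]
  have h8 := pos_of_mul_pos_left h7 (sq_nonneg _)
  have h9 : Real.sqrt 3 < 2 - a := (Real.sqrt_lt' (by linarith)).2 (by nlinarith)
  linarith

/-- For `x ∈ 𝔹ⁿ` and `0 < r < r₀ = (1−|x|)/√(2(1+|x|²))`, with
`r₁ = |x|/√(1+|x|²)`, `r₂ = 2|x|/(1+|x|²)`,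
`M = log[(1−|x|)(1−r²(1+|x|²)) / (1−|x| − r(1+|x|²)(r+√(1−r²)))]`,
`m₁ = log(1 + r(1+|x|²)(√(1−r²)−r|x|)/((1−|x|)(1−r²(1+|x|²))))` if `r ∈ I₁` or
(`|x| < √2−1` and `r ∈ I₂`), and `m₁ = ∞` otherwise;
`m₂ = log[(1+|x|)(1−r²(1+|x|²))/(1+|x| − r(r+√(1−r²))(1+|x|²))]` if
`|x| < 2−√3` and `r₂ ≤ r < r₀`, and `m₂ = ∞` otherwise; `m = min{m₁,m₂}`.
Then `B_j(x,m) ⊂ B_q(x,r)` and `B_q(x,r) ⊂ B_j(x,M)`. -/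
theorem stmt_14 {n : ℕ} (hn : 2 ≤ n) (x : EuclideanSpace ℝ (Fin n)) (hx : ‖x‖ < 1)
    (r : ℝ) (hr : 0 < r) (hr0 : r < (1 - ‖x‖) / Real.sqrt (2 * (1 + ‖x‖ ^ 2))) :
    let r₀ : ℝ := (1 - ‖x‖) / Real.sqrt (2 * (1 + ‖x‖ ^ 2))
    let r₁ : ℝ := ‖x‖ / Real.sqrt (1 + ‖x‖ ^ 2)
    let r₂ : ℝ := 2 * ‖x‖ / (1 + ‖x‖ ^ 2)
    let M : ℝ := Real.log ((1 - ‖x‖) * (1 - r ^ 2 * (1 + ‖x‖ ^ 2)) /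
      (1 - ‖x‖ - r * (1 + ‖x‖ ^ 2) * (r + Real.sqrt (1 - r ^ 2))))
    let m₁ : EReal :=
      if r < min r₀ r₁ ∨
          (‖x‖ < Real.sqrt 2 - 1 ∧ min r₀ r₁ ≤ r ∧ r < min r₀ r₂) then
        ((Real.log (1 + r * (1 + ‖x‖ ^ 2) * (Real.sqrt (1 - r ^ 2) - r * ‖x‖) /
          ((1 - ‖x‖) * (1 - r ^ 2 * (1 + ‖x‖ ^ 2)))) : ℝ) : EReal)
      else ⊤
    let m₂ : EReal :=
      if ‖x‖ < 2 - Real.sqrt 3 ∧ r₂ ≤ r ∧ r < r₀ then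
        ((Real.log ((1 + ‖x‖) * (1 - r ^ 2 * (1 + ‖x‖ ^ 2)) /
          (1 + ‖x‖ - r * (r + Real.sqrt (1 - r ^ 2)) * (1 + ‖x‖ ^ 2))) : ℝ) : EReal)
      else ⊤
    let m : EReal := min m₁ m₂
    (∀ y : EuclideanSpace ℝ (Fin n), ‖y‖ < 1 →
      ((jdist x y : ℝ) : EReal) < m → qdist x y < r) ∧
    (∀ y : EuclideanSpace ℝ (Fin n), qdist x y < r → ‖y‖ < 1 ∧ jdist x y < M) := by
  intro r₀ r₁ r₂ M m₁ m₂ m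
  have ha0 := norm_nonneg x
  have h2 := sq_mul_lt_of_lt_radius hx hr hr0
  have hD := one_sub_sq_mul_pos ha0 hx h2
  have hE := one_sub_sub_pos ha0 hx h2
  have hsa := mul_lt_sqrt_one_sub_sq hD
  have hd : 0 < r * (1 + ‖x‖ ^ 2) * (Real.sqrt (1 - r ^ 2) - r * ‖x‖) :=
    mul_pos (by positivity) (by linarith)
  refine ⟨fun y hy hj => qdist_lt_of_norm_sub_lt hr hD ?_, fun y hq => ?_⟩
  · obtain ⟨hj₁, hj₂⟩ := lt_min_iff.1 hj
    rcases lt_radius_cases ha0 hx h2 hr0 with h | h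
    · have hj' : ((jdist x y : ℝ) : EReal) < ((_ : ℝ) : EReal) := hj₁.trans_eq (if_pos h)
      rw [EReal.coe_lt_coe_iff, jdist_lt_log_iff hx hy (by have := sub_pos.2 hx; positivity)] at hj'
      calc ‖x - y‖ < _ := hj'
        _ ≤ r * (1 + ‖x‖ ^ 2) * (Real.sqrt (1 - r ^ 2) - r * ‖x‖) /
            ((1 - ‖x‖) * (1 - r ^ 2 * (1 + ‖x‖ ^ 2))) * (1 - ‖x‖) := by
          have := sub_pos.2 hx
          gcongr
          exact min_le_left _ _
        _ = _ := by
          have := (sub_pos.2 hx).ne'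
          field_simp
    · have hj' : ((jdist x y : ℝ) : EReal) < ((_ : ℝ) : EReal) := hj₂.trans_eq (if_pos h)
      have hF : 0 < 1 + ‖x‖ - r * (r + Real.sqrt (1 - r ^ 2)) * (1 + ‖x‖ ^ 2) := by linarith
      have hlog : (1 + ‖x‖) * (1 - r ^ 2 * (1 + ‖x‖ ^ 2)) /
          (1 + ‖x‖ - r * (r + Real.sqrt (1 - r ^ 2)) * (1 + ‖x‖ ^ 2)) =
          1 + r * (1 + ‖x‖ ^ 2) * (Real.sqrt (1 - r ^ 2) - r * ‖x‖) /
            (1 + ‖x‖ - r * (r + Real.sqrt (1 - r ^ 2)) * (1 + ‖x‖ ^ 2)) := by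
        rw [one_add_div hF.ne']
        congr 1
        ring
      rw [EReal.coe_lt_coe_iff, hlog, jdist_lt_log_iff hx hy (by positivity)] at hj'
      have hxy : ‖x - y‖ ≤ ‖x‖ + ‖y‖ := norm_sub_le x y
      have hlt : ‖x - y‖ < r * (1 + ‖x‖ ^ 2) * (Real.sqrt (1 - r ^ 2) - r * ‖x‖) /
          (1 + ‖x‖ - r * (r + Real.sqrt (1 - r ^ 2)) * (1 + ‖x‖ ^ 2)) *
          (1 + ‖x‖ - ‖x - y‖) := by
        refine hj'.trans_le (mul_le_mul_of_nonneg_left ?_ (by positivity))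
        exact (min_le_right _ _).trans (by linarith)
      rw [div_mul_eq_mul_div, lt_div_iff₀ hF] at hlt
      rw [lt_div_iff₀ hD]
      have hpos : 0 < 1 + ‖x‖ := by positivity
      refine lt_of_mul_lt_mul_left ?_ hpos.le
      linarith
  · have he := norm_sub_lt_of_qdist_lt hr hD hq
    have hy : ‖y‖ ≤ ‖x‖ + ‖x - y‖ := by
      simpa using norm_sub_le x (x - y)
    rw [lt_div_iff₀ hD] at he
    have he1 : ‖x - y‖ < 1 - ‖x‖ := by
      refine lt_of_mul_lt_mul_right (he.trans ?_) hD.le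
      linarith
    have hy1 : ‖y‖ < 1 := by linarith
    refine ⟨hy1, ?_⟩
    have hlog : (1 - ‖x‖) * (1 - r ^ 2 * (1 + ‖x‖ ^ 2)) /
        (1 - ‖x‖ - r * (1 + ‖x‖ ^ 2) * (r + Real.sqrt (1 - r ^ 2))) =
        1 + r * (1 + ‖x‖ ^ 2) * (Real.sqrt (1 - r ^ 2) + r * ‖x‖) /
          (1 - ‖x‖ - r * (1 + ‖x‖ ^ 2) * (r + Real.sqrt (1 - r ^ 2))) := by
      rw [one_add_div hE.ne']
      congr 1
      ring
    change jdist x y < Real.log _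
    rw [hlog, jdist_lt_log_iff hx hy1 (by positivity)]
    have hmin : 1 - ‖x‖ - ‖x - y‖ ≤ min (1 - ‖x‖) (1 - ‖y‖) :=
      le_min (by linarith [norm_nonneg (x - y)]) (by linarith)
    refine lt_of_lt_of_le ?_ (mul_le_mul_of_nonneg_left hmin (by positivity))
    rw [div_mul_eq_mul_div, lt_div_iff₀ hE]
    have := mul_lt_mul_of_pos_right he (sub_pos.2 hx)
    linarith
end

section
/- Let n ≥ 2, let x ∈ 𝔹ⁿ and r > 0. Set m = (1−|x|²)·sinh(r/2) / (√(1+|x|²)·√((1+|x|²)·cosh r + 2|x|·sinh r)) and M = (1−|x|²)·sinh(r/2) / (√(1+|x|²)·√((1+|x|²)·cosh r − 2|x|·sinh r)). Then B_q(x, m) ⊂ B_ρ(x, r) and B_ρ(x, r) ⊂ B_q(x, M). -/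
open Real Set

lemma div_sqrt_mul_sqrt_lt_iff {d N A B k : ℝ} (hd : 0 ≤ d) (hN : 0 ≤ N) (hA : 0 < A)
    (hB : 0 < B) (hk : 0 < k) :
    d / (√A * √B) < N / (√A * √k) ↔ d ^ 2 * k < N ^ 2 * B := by
  have hA' := Real.sqrt_pos.2 hA
  have hB' := Real.sqrt_pos.2 hB
  have hk' := Real.sqrt_pos.2 hk
  rw [mul_comm √A √B, mul_comm √A √k, ← div_div, ← div_div, div_lt_div_iff_of_pos_right hA',
    div_lt_div_iff₀ hB' hk', ← pow_lt_pow_iff_left₀ (by positivity) (by positivity) two_ne_zero,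
    mul_pow, mul_pow, Real.sq_sqrt hk.le, Real.sq_sqrt hB.le]

lemma rhodist_lt_iff {n : ℕ} {x y : EuclideanSpace ℝ (Fin n)} (hx : ‖x‖ < 1) (hy : ‖y‖ < 1)
    {r : ℝ} (hr : 0 < r) :
    rhodist x y < r ↔
      ‖x - y‖ ^ 2 < Real.sinh (r / 2) ^ 2 * (1 - ‖x‖ ^ 2) * (1 - ‖y‖ ^ 2) := by
  have hX : 0 < 1 - ‖x‖ ^ 2 := by nlinarith [norm_nonneg x]
  have hY : 0 < 1 - ‖y‖ ^ 2 := by nlinarith [norm_nonneg y]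
  have hs : 0 < Real.sinh (r / 2) := Real.sinh_pos_iff.2 (by linarith)
  have hX' := Real.sqrt_pos.2 hX
  have hY' := Real.sqrt_pos.2 hY
  rw [rhodist, ← lt_div_iff₀' two_pos, ← Real.sinh_lt_sinh, Real.sinh_arsinh,
    div_lt_iff₀ (by positivity),
    ← pow_lt_pow_iff_left₀ (norm_nonneg _) (by positivity) two_ne_zero,
    mul_pow, mul_pow, Real.sq_sqrt hX.le, Real.sq_sqrt hY.le, mul_assoc]

/-- If `|x| = a`, `|y| = b`, `|x - y|² = u`, `C = cosh (r/2)` and `s = sinh (r/2)`, this is the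
inclusion of the chordal ball in the hyperbolic ball. -/
lemma hyperbolic_of_chordal {a b s C u : ℝ} (ha : 0 ≤ a) (ha1 : a < 1) (hb : 0 ≤ b)
    (hs : 0 < s) (hC : 0 < C) (hCs : C ^ 2 = 1 + s ^ 2) (hu : (b - a) ^ 2 ≤ u)
    (h : u * ((C + a * s) ^ 2 + (a * C + s) ^ 2) < ((1 - a ^ 2) * s) ^ 2 * (1 + b ^ 2)) :
    u < s ^ 2 * (1 - a ^ 2) * (1 - b ^ 2) := by
  have hX : 0 < 1 - a ^ 2 := by nlinarith
  set p := C + a * s with hp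
  set q := a * C + s with hq
  have hp0 : 0 < p := by positivity
  have hq0 : 0 < q := by positivity
  have hpq : p ^ 2 - q ^ 2 = 1 - a ^ 2 := by rw [hp, hq]; linear_combination (1 - a ^ 2) * hCs
  have hqp : q - a * p = (1 - a ^ 2) * s := by rw [hp, hq]; ring
  have hXs : 0 < (1 - a ^ 2) * s := by positivity
  clear_value p q
  rcases le_total (b * p) q with hle | hge
  · have hsq : (b * p) ^ 2 ≤ q ^ 2 := by gcongr
    have hmain : ((1 - a ^ 2) * s) ^ 2 * (1 + b ^ 2)
        ≤ s ^ 2 * (1 - a ^ 2) * (1 - b ^ 2) * (p ^ 2 + q ^ 2) := by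
      have : (1 - a ^ 2) * (1 + b ^ 2) ≤ (1 - b ^ 2) * (p ^ 2 + q ^ 2) := by
        rw [← hpq]; linarith
      have := mul_le_mul_of_nonneg_left this (by positivity : 0 ≤ s ^ 2 * (1 - a ^ 2))
      linarith
    exact lt_of_mul_lt_mul_right (h.trans_le hmain) (by positivity)
  · exfalso
    rw [← hqp] at h hXs
    have h1 : (q - a * p) ^ 2 ≤ ((b - a) * p) ^ 2 :=
      pow_le_pow_left₀ hXs.le (by linarith) 2
    have h2 : ((q - a * p) * b) ^ 2 ≤ ((b - a) * q) ^ 2 := by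
      refine pow_le_pow_left₀ (by positivity) ?_ 2
      nlinarith [mul_le_mul_of_nonneg_left hge ha]
    have h3 := mul_le_mul_of_nonneg_right hu (by positivity : 0 ≤ p ^ 2 + q ^ 2)
    linarith

/-- If `|x| = a`, `|y| = b`, `|x - y|² = u`, `C = cosh (r/2)` and `s = sinh (r/2)`, this is the
inclusion of the hyperbolic ball in the chordal ball. -/
lemma chordal_of_hyperbolic {a b s C u : ℝ} (ha : 0 ≤ a) (ha1 : a < 1) (hb : 0 ≤ b)
    (hb1 : b < 1) (hs : 0 < s) (hC : 0 < C) (hCs : C ^ 2 = 1 + s ^ 2)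
    (hu : (b - a) ^ 2 ≤ u) (hu' : u ≤ (a + b) ^ 2)
    (h : u < s ^ 2 * (1 - a ^ 2) * (1 - b ^ 2)) :
    u * ((C - a * s) ^ 2 + (a * C - s) ^ 2) < ((1 - a ^ 2) * s) ^ 2 * (1 + b ^ 2) := by
  have hX : 0 < 1 - a ^ 2 := by nlinarith
  have hsC : s < C := by nlinarith
  have hab : 0 < 1 - a * b := by nlinarith
  have hp0 : 0 < C - a * s := by nlinarith
  rcases lt_or_ge (b * (C - a * s)) |a * C - s| with hlt | hge
  · rcases le_total 0 (a * C - s) with hq | hq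
    · exfalso
      rw [abs_of_nonneg hq] at hlt
      have h1 : (s * (1 - a * b)) ^ 2 ≤ ((a - b) * C) ^ 2 :=
        pow_le_pow_left₀ (by positivity) (by linarith) 2
      have h2 : s ^ 2 * (1 - a ^ 2) * (1 - b ^ 2) ≤ (b - a) ^ 2 := by
        linear_combination h1 + (a - b) ^ 2 * hCs
      linarith
    · rw [abs_of_nonpos hq] at hlt
      set p := C - a * s with hp
      obtain ⟨Q, hQ⟩ : ∃ Q, Q = s - a * C := ⟨_, rfl⟩
      have hqQ : a * C - s = -Q := by linarith
      have hXs : (1 - a ^ 2) * s = a * p + Q := by rw [hp, hQ]; ring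
      have hQp : Q < p := by
        have : 0 < (1 + a) * (C - s) := mul_pos (by linarith) (by linarith)
        rw [hp, hQ]; linarith
      rw [hqQ] at hlt ⊢
      rw [hXs]
      clear_value p
      rw [neg_neg] at hlt
      have hQ0 : 0 < Q := lt_of_le_of_lt (by positivity) hlt
      have hbQ : b * Q < p := by nlinarith
      have hdiff : 0 < (Q - b * p) * ((1 - a ^ 2) * (b * p + Q) + 2 * a * (p - b * Q)) :=
        mul_pos (by linarith) (add_pos_of_pos_of_nonneg (by positivity)
          (mul_nonneg (by positivity) (by linarith)))
      have h3 := mul_le_mul_of_nonneg_right hu' (by positivity : 0 ≤ p ^ 2 + (-Q) ^ 2)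
      linarith
  · have hsq : (a * C - s) ^ 2 ≤ (b * (C - a * s)) ^ 2 := by
      rw [← sq_abs (a * C - s)]; gcongr
    set p := C - a * s with hp
    set q := a * C - s with hq
    have hpq : p ^ 2 - q ^ 2 = 1 - a ^ 2 := by rw [hp, hq]; linear_combination (1 - a ^ 2) * hCs
    clear_value p q
    have hle : (1 - b ^ 2) * (p ^ 2 + q ^ 2) ≤ (1 - a ^ 2) * (1 + b ^ 2) := by
      rw [← hpq]; linarith
    have h1 := mul_le_mul_of_nonneg_left hle (by positivity : 0 ≤ s ^ 2 * (1 - a ^ 2))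
    have h2 := mul_lt_mul_of_pos_right h (by positivity : 0 < p ^ 2 + q ^ 2)
    linarith

/-- For `x ∈ 𝔹ⁿ` and `r > 0`, with
`m = (1−|x|²)·sinh(r/2)/(√(1+|x|²)·√((1+|x|²)·cosh r + 2|x|·sinh r))` and
`M = (1−|x|²)·sinh(r/2)/(√(1+|x|²)·√((1+|x|²)·cosh r − 2|x|·sinh r))`,
one has `B_q(x,m) ⊂ B_ρ(x,r)` and `B_ρ(x,r) ⊂ B_q(x,M)`. -/
theorem stmt_18 {n : ℕ} (hn : 2 ≤ n) (x : EuclideanSpace ℝ (Fin n)) (hx : ‖x‖ < 1)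
    (r : ℝ) (hr : 0 < r) :
    let m : ℝ := (1 - ‖x‖ ^ 2) * Real.sinh (r / 2) /
      (Real.sqrt (1 + ‖x‖ ^ 2) *
        Real.sqrt ((1 + ‖x‖ ^ 2) * Real.cosh r + 2 * ‖x‖ * Real.sinh r))
    let M : ℝ := (1 - ‖x‖ ^ 2) * Real.sinh (r / 2) /
      (Real.sqrt (1 + ‖x‖ ^ 2) *
        Real.sqrt ((1 + ‖x‖ ^ 2) * Real.cosh r - 2 * ‖x‖ * Real.sinh r))
    (∀ y : EuclideanSpace ℝ (Fin n), qdist x y < m → ‖y‖ < 1 ∧ rhodist x y < r) ∧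
    (∀ y : EuclideanSpace ℝ (Fin n), ‖y‖ < 1 → rhodist x y < r → qdist x y < M) := by
  have ha := norm_nonneg x
  have hX : 0 < 1 - ‖x‖ ^ 2 := by nlinarith
  have hs : 0 < Real.sinh (r / 2) := Real.sinh_pos_iff.2 (by linarith)
  have hC := Real.cosh_pos (r / 2)
  have hCs := Real.cosh_sq' (r / 2)
  have hN : 0 ≤ (1 - ‖x‖ ^ 2) * Real.sinh (r / 2) := by positivity
  have hr2 : r = 2 * (r / 2) := by ring
  have hK : (1 + ‖x‖ ^ 2) * Real.cosh r + 2 * ‖x‖ * Real.sinh r =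
      (Real.cosh (r / 2) + ‖x‖ * Real.sinh (r / 2)) ^ 2 +
        (‖x‖ * Real.cosh (r / 2) + Real.sinh (r / 2)) ^ 2 := by
    conv_lhs => rw [hr2, Real.cosh_two_mul, Real.sinh_two_mul]
    ring
  have hL : (1 + ‖x‖ ^ 2) * Real.cosh r - 2 * ‖x‖ * Real.sinh r =
      (Real.cosh (r / 2) - ‖x‖ * Real.sinh (r / 2)) ^ 2 +
        (‖x‖ * Real.cosh (r / 2) - Real.sinh (r / 2)) ^ 2 := by
    conv_lhs => rw [hr2, Real.cosh_two_mul, Real.sinh_two_mul]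
    ring
  have hp : 0 < Real.cosh (r / 2) - ‖x‖ * Real.sinh (r / 2) := by
    nlinarith [Real.sinh_lt_cosh (r / 2)]
  have hdist (y : EuclideanSpace ℝ (Fin n)) : (‖y‖ - ‖x‖) ^ 2 ≤ ‖x - y‖ ^ 2 := by
    rw [norm_sub_rev x y]
    exact sq_le_sq.2 ((abs_norm_sub_norm_le y x).trans (le_abs_self _))
  intro m M
  refine ⟨fun y h ↦ ?_, fun y hy h ↦ ?_⟩
  · rw [qdist, div_sqrt_mul_sqrt_lt_iff (norm_nonneg _) hN (by positivity) (by positivity)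
      (by rw [hK]; positivity), hK] at h
    have hu := hyperbolic_of_chordal ha hx (norm_nonneg y) hs hC hCs (hdist y) h
    have hy : ‖y‖ < 1 := by
      have h0 : 0 < 1 - ‖y‖ ^ 2 :=
        pos_of_mul_pos_right ((sq_nonneg _).trans_lt hu) (by positivity)
      nlinarith [norm_nonneg y]
    exact ⟨hy, (rhodist_lt_iff hx hy hr).2 hu⟩
  · rw [qdist, div_sqrt_mul_sqrt_lt_iff (norm_nonneg _) hN (by positivity) (by positivity)
      (by rw [hL]; positivity), hL]
    exact chordal_of_hyperbolic ha hx (norm_nonneg y) hy hs hC hCs (hdist y)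
      (by gcongr; exact norm_sub_le x y) ((rhodist_lt_iff hx hy hr).1 h)
end
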